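/- Assume G is connected, the voltage upper bounds are uniform, V̄_1=⋯=V̄_n>0, p̲_i≤0 for all i∈N, and each f_i is strictly increasing. Let (p*,v*,W*) be an optimal solution of RL2 with Σ_{i∈N} p*_i > 0. If either (i) no line constraint is binding at (p*,v*,W*), i.e., y_{ij}²(v*_i−W*_{ij}−W*_{ji}+v*_j) < Ī_{ij}² for every edge i∼j, or (ii) for every edge s∼t on which the line constraint is binding one has p*_s > p̲_s and p*_t > p̲_t, then (p*,v*,W*) satisfies the rank constraint W*_{ij}W*_{ji} = v*_i v*_j on every edge i∼j; that is, RL2 is exact. -/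

import Mathlib

open Finset

/-- Power injection at bus `i` determined by `(v, W)` and conductances `y`. -/
def inj {n : ℕ} (G : SimpleGraph (Fin n)) [DecidableRel G.Adj]
    (y : Fin n → Fin n → ℝ) (v : Fin n → ℝ) (W : Fin n → Fin n → ℝ) (i : Fin n) : ℝ :=
  ∑ j ∈ univ.filter (fun j => G.Adj i j), (v i - W i j) * y i j

/-- Feasibility for the SOCP relaxation RL1. -/
def FeasRL1 {n : ℕ} (G : SimpleGraph (Fin n)) [DecidableRel G.Adj]
    (y : Fin n → Fin n → ℝ) (pLo pHi VLo VHi : Fin n → ℝ)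
    (p v : Fin n → ℝ) (W : Fin n → Fin n → ℝ) : Prop :=
  (∀ i, p i = inj G y v W i) ∧
  (∀ i, pLo i ≤ p i ∧ p i ≤ pHi i) ∧
  (∀ i, VLo i ^ 2 ≤ v i ∧ v i ≤ VHi i ^ 2) ∧
  (∀ i j, G.Adj i j → 0 ≤ W i j) ∧
  (∀ i j, G.Adj i j → W i j = W j i) ∧
  (∀ i j, G.Adj i j → W i j * W j i ≤ v i * v j)

/-- Feasibility for RL2 = RL1 together with the line (current) constraints. -/
def FeasRL2 {n : ℕ} (G : SimpleGraph (Fin n)) [DecidableRel G.Adj]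
    (y : Fin n → Fin n → ℝ) (pLo pHi VLo VHi : Fin n → ℝ)
    (Ibar : Fin n → Fin n → ℝ)
    (p v : Fin n → ℝ) (W : Fin n → Fin n → ℝ) : Prop :=
  FeasRL1 G y pLo pHi VLo VHi p v W ∧
  ∀ i j, G.Adj i j → y i j ^ 2 * (v i - W i j - W j i + v j) ≤ Ibar i j ^ 2

/-- Optimality for RL2. -/
def OptRL2 {n : ℕ} (G : SimpleGraph (Fin n)) [DecidableRel G.Adj]
    (y : Fin n → Fin n → ℝ) (pLo pHi VLo VHi : Fin n → ℝ)
    (Ibar : Fin n → Fin n → ℝ) (f : Fin n → ℝ → ℝ)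
    (p v : Fin n → ℝ) (W : Fin n → Fin n → ℝ) : Prop :=
  FeasRL2 G y pLo pHi VLo VHi Ibar p v W ∧
  ∀ q u X, FeasRL2 G y pLo pHi VLo VHi Ibar q u X →
    ∑ i, f i (p i) ≤ ∑ i, f i (q i)

section Exactness

variable {n : ℕ} {G : SimpleGraph (Fin n)} [DecidableRel G.Adj] {y : Fin n → Fin n → ℝ}
  {pLo pHi VLo VHi : Fin n → ℝ} {Ibar : Fin n → Fin n → ℝ} {f : Fin n → ℝ → ℝ}
  {p v : Fin n → ℝ} {W : Fin n → Fin n → ℝ}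

/-- The power injection is linear in `(v, W)`. -/
theorem inj_add_smul (a : Fin n → ℝ) (b : Fin n → Fin n → ℝ) (ε : ℝ) (i : Fin n) :
    inj G y (fun i => v i + ε * a i) (fun i j => W i j + ε * b i j) i =
      inj G y v W i + ε * inj G y a b i := by
  simp only [inj, Finset.mul_sum, ← Finset.sum_add_distrib]
  exact Finset.sum_congr rfl fun j _ => by ring

/-- A strict inequality survives small perturbations that are continuous in the step size. -/
theorem eventually_lt_of_continuous {g h : ℝ → ℝ} (hg : Continuous g) (hh : Continuous h)
    (hlt : g 0 < h 0) : ∀ᶠ ε in nhdsWithin (0 : ℝ) (Set.Ioi 0), g ε < h ε :=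
  (hg.continuousAt.eventually_lt hh.continuousAt hlt).filter_mono nhdsWithin_le_nhds

/-- A bus without positive injection and with a rank-deficient line is below its upper voltage
bound. -/
theorem voltage_lt_of_strict_edge (hVHiuni : ∀ i j, VHi i = VHi j)
    (hVHipos : ∀ i, 0 < VHi i)
    (hy : ∀ i j, G.Adj i j → 0 < y i j) (hfeas : FeasRL1 G y pLo pHi VLo VHi p v W)
    {s t : Fin n} (hst : G.Adj s t) (hstrict : W s t * W t s < v s * v t) (hps : p s ≤ 0) :
    v s < VHi s ^ 2 := by
  obtain ⟨hp, -, hv, -, hWsym, hrank⟩ := hfeas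
  by_contra! hge
  have hM : 0 < VHi s ^ 2 := pow_pos (hVHipos s) 2
  have hvs : v s = VHi s ^ 2 := le_antisymm (hv s).2 hge
  have hvj : ∀ j, v j ≤ v s := fun j => by rw [hvs, hVHiuni s j]; exact (hv j).2
  have hvpos : 0 < v s := hvs ▸ hM
  have hmul : ∀ j, v s * v j ≤ v s * v s := fun j =>
    mul_le_mul_of_nonneg_left (hvj j) hvpos.le
  have hpos : 0 < inj G y v W s := by
    refine Finset.sum_pos' (fun j hj => ?_) ⟨t, by simpa using hst, ?_⟩
    · have hj' : G.Adj s j := by simpa using hj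
      have h1 := hrank s j hj'
      rw [← hWsym s j hj'] at h1
      have : W s j ≤ v s := by nlinarith [hmul j]
      exact mul_nonneg (sub_nonneg.2 this) (hy s j hj').le
    · rw [← hWsym s t hst] at hstrict
      have : W s t < v s := by nlinarith [hmul t]
      exact mul_pos (sub_pos.2 this) (hy s t hst)
  linarith [hp s]

/-- At an optimum whose binding lines join buses with slack lower injection bounds, an endpoint
`s` of a rank-deficient line has a binding lower injection bound; moreover the injections are
attained by another optimum of the same kind at which every line at `s` is rank-deficient. -/
theorem propagate_strict_edge (hVHiuni : ∀ i j, VHi i = VHi j)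
    (hVHipos : ∀ i, 0 < VHi i) (hVLo : ∀ i, 0 < VLo i) (hpLo : ∀ i, pLo i ≤ 0)
    (hy : ∀ i j, G.Adj i j → 0 < y i j) (hf : ∀ i, StrictMono (f i))
    (hopt : OptRL2 G y pLo pHi VLo VHi Ibar f p v W)
    (hbind : ∀ i j, G.Adj i j → y i j ^ 2 * (v i - W i j - W j i + v j) = Ibar i j ^ 2 →
      pLo i < p i ∧ pLo j < p j)
    {s t : Fin n} (hst : G.Adj s t) (hstrict : W s t * W t s < v s * v t) :
    p s = pLo s ∧ ∃ (u : Fin n → ℝ) (X : Fin n → Fin n → ℝ),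
      OptRL2 G y pLo pHi VLo VHi Ibar f p u X ∧
      (∀ i j, G.Adj i j → y i j ^ 2 * (u i - X i j - X j i + u j) = Ibar i j ^ 2 →
        pLo i < p i ∧ pLo j < p j) ∧
      ∀ j, G.Adj s j → X s j * X j s < u s * u j := by
  obtain ⟨⟨hfeas, hline⟩, hmin⟩ := hopt
  have hvlt : ∀ {i j}, G.Adj i j → W i j * W j i < v i * v j → p i ≤ 0 → v i < VHi i ^ 2 :=
    fun h => voltage_lt_of_strict_edge hVHiuni hVHipos hy hfeas h
  obtain ⟨hp, hpb, hv, hW0, hWsym, hrank⟩ := hfeas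
  have hvpos : ∀ i, 0 < v i := fun i => (pow_pos (hVLo i) 2).trans_le (hv i).1
  have hstrict' : W t s * W s t < v t * v s := by linarith
  have hne : s ≠ t := hst.ne
  let b : Fin n → Fin n → ℝ := fun i j => if (i = s ∧ j = t) ∨ (i = t ∧ j = s) then 1 else 0
  let e : Fin n → ℝ := fun i => ∑ j ∈ univ.filter (fun j => G.Adj i j), b i j * y i j
  let d : Fin n → ℝ := fun i => ∑ j ∈ univ.filter (fun j => G.Adj i j), y i j
  let a : Fin n → ℝ := fun i => if pLo i < p i then 0 else e i / d i
  have hb0 : ∀ i j, 0 ≤ b i j := fun i j => by dsimp only [b]; split_ifs <;> norm_num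
  have hb1 : ∀ i j, b i j ≤ 1 := fun i j => by dsimp only [b]; split_ifs <;> norm_num
  have hbsym : ∀ i j, b i j = b j i := fun i j => by
    dsimp only [b]; congr 1; apply propext; tauto
  have hby : ∀ i j, j ∈ univ.filter (fun j => G.Adj i j) → 0 < y i j :=
    fun i j hj => hy i j (by simpa using hj)
  have he0 : ∀ i, 0 ≤ e i := fun i =>
    Finset.sum_nonneg fun j hj => mul_nonneg (hb0 i j) (hby i j hj).le
  have hd0 : ∀ i, 0 ≤ d i := fun i => Finset.sum_nonneg fun j hj => (hby i j hj).le
  have hed : ∀ i, e i ≤ d i := fun i =>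
    Finset.sum_le_sum fun j hj => mul_le_of_le_one_left (hby i j hj).le (hb1 i j)
  have hes : 0 < e s := Finset.sum_pos' (fun j hj => mul_nonneg (hb0 s j) (hby s j hj).le)
    ⟨t, by simpa using hst, by simpa [b] using hy s t hst⟩
  have hei : ∀ i, i ≠ s → i ≠ t → e i = 0 := fun i h1 h2 =>
    Finset.sum_eq_zero fun j _ => by simp [b, h1, h2]
  have ha0 : ∀ i, 0 ≤ a i := fun i => by
    dsimp only [a]; split_ifs
    exacts [le_rfl, div_nonneg (he0 i) (hd0 i)]
  have hinj : ∀ i, inj G y a b i = a i * d i - e i := fun i => by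
    simp only [inj, d, e, Finset.mul_sum, ← Finset.sum_sub_distrib]
    exact Finset.sum_congr rfl fun j _ => by ring
  have hc : ∀ i, inj G y a b i = if pLo i < p i then -e i else 0 := fun i => by
    rw [hinj]
    by_cases h : pLo i < p i
    · simp [a, h]
    · simp only [a, h, if_false]
      rw [div_mul_cancel_of_imp, sub_self]
      exact fun h0 => le_antisymm (h0 ▸ hed i) (he0 i)
  have hc0 : ∀ i, inj G y a b i ≤ 0 := fun i => by
    rw [hc]; split_ifs
    exacts [neg_nonpos.2 (he0 i), le_rfl]
  have hav : ∀ i, a i = 0 ∨ v i < VHi i ^ 2 := fun i => by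
    by_cases h : pLo i < p i
    · left; simp [a, h]
    have hpi : p i ≤ 0 := (not_lt.1 h).trans (hpLo i)
    by_cases h1 : i = s
    · subst h1; exact .inr (hvlt hst hstrict hpi)
    by_cases h2 : i = t
    · subst h2; exact .inr (hvlt hst.symm hstrict' hpi)
    · left; simp [a, hei i h1 h2]
  have hev : ∀ᶠ ε in nhdsWithin (0 : ℝ) (Set.Ioi 0),
      (∀ i, pLo i ≤ p i + ε * inj G y a b i) ∧
      (∀ i, v i + ε * a i ≤ VHi i ^ 2) ∧
      ((W s t + ε) * (W t s + ε) < (v s + ε * a s) * (v t + ε * a t)) ∧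
      ∀ i j, G.Adj i j → y i j ^ 2 * (v i - W i j - W j i + v j) < Ibar i j ^ 2 →
        y i j ^ 2 * ((v i + ε * a i) - (W i j + ε * b i j) - (W j i + ε * b j i)
          + (v j + ε * a j)) < Ibar i j ^ 2 := by
    simp only [Filter.eventually_and, Filter.eventually_all]
    refine ⟨fun i => ?_, fun i => ?_, ?_, fun i j _ hlt => ?_⟩
    · by_cases h : pLo i < p i
      · exact (eventually_lt_of_continuous (g := fun _ => pLo i)
          (h := fun ε => p i + ε * inj G y a b i) (by fun_prop) (by fun_prop)
          (by simpa using h)).mono fun _ => le_of_lt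
      · simp [hc i, h, (hpb i).1]
    · rcases hav i with h | h
      · simp [h, (hv i).2]
      · exact (eventually_lt_of_continuous (g := fun ε => v i + ε * a i)
          (h := fun _ => VHi i ^ 2) (by fun_prop) (by fun_prop)
          (by simpa using h)).mono fun _ => le_of_lt
    · exact eventually_lt_of_continuous (by fun_prop) (by fun_prop) (by simpa using hstrict)
    · exact eventually_lt_of_continuous (by fun_prop) (by fun_prop) (by simpa using hlt)
  obtain ⟨ε, ⟨hεp, hεv, hεst, hεline⟩, hε⟩ := (hev.and self_mem_nhdsWithin).exists
  have hε : 0 < ε := hε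
  let u : Fin n → ℝ := fun i => v i + ε * a i
  let X : Fin n → Fin n → ℝ := fun i j => W i j + ε * b i j
  have huv : ∀ i, v i ≤ u i := fun i => le_add_of_nonneg_right (mul_nonneg hε.le (ha0 i))
  have hmul : ∀ i j, v i * v j ≤ u i * u j := fun i j =>
    mul_le_mul (huv i) (huv j) (hvpos j).le ((hvpos i).le.trans (huv i))
  have hXst : X s t * X t s < u s * u t := by simpa [X, u, b] using hεst
  have hnot : ∀ {i j}, ¬((i = s ∧ j = t) ∨ (i = t ∧ j = s)) →
      X i j = W i j ∧ X j i = W j i := fun {i j} h => by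
    have h1 : b i j = 0 := if_neg h
    have h2 : b j i = 0 := hbsym i j ▸ h1
    simp [X, h1, h2]
  have hfeas' : FeasRL2 G y pLo pHi VLo VHi Ibar (fun i => p i + ε * inj G y a b i) u X := by
    refine ⟨⟨fun i => ?_, fun i => ⟨hεp i, ?_⟩, fun i => ⟨(hv i).1.trans (huv i), hεv i⟩,
      fun i j h => add_nonneg (hW0 i j h) (mul_nonneg hε.le (hb0 i j)), fun i j h => ?_,
      fun i j h => ?_⟩, fun i j h => ?_⟩
    · rw [inj_add_smul, ← hp i]
    · nlinarith [hc0 i, (hpb i).2]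
    · simp only [X, hWsym i j h, hbsym i j]
    · by_cases hij : (i = s ∧ j = t) ∨ (i = t ∧ j = s)
      · rcases hij with ⟨rfl, rfl⟩ | ⟨rfl, rfl⟩ <;> linarith
      · rw [(hnot hij).1, (hnot hij).2]
        exact (hrank i j h).trans (hmul i j)
    · rcases (hline i j h).lt_or_eq with hlt | heq
      · exact (hεline i j h hlt).le
      · obtain ⟨h1, h2⟩ := hbind i j h heq
        have hai : a i = 0 := if_pos h1
        have haj : a j = 0 := if_pos h2
        refine le_trans (mul_le_mul_of_nonneg_left ?_ (sq_nonneg _)) heq.le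
        simp only [u, X, hai, haj]
        nlinarith [hb0 i j, hb0 j i]
  have hps : ¬ pLo s < p s := fun hslack => by
    refine (hmin _ _ _ hfeas').not_gt (Finset.sum_lt_sum (fun i _ => (hf i).monotone ?_)
      ⟨s, mem_univ s, hf s ?_⟩)
    · nlinarith [hc0 i]
    · rw [hc, if_pos hslack]; nlinarith
  by_cases hpt : pLo t < p t
  · have het : 0 < e t := Finset.sum_pos'
      (fun j hj => mul_nonneg (hb0 t j) (hby t j hj).le)
      ⟨s, by simpa using hst.symm, by simpa [b] using hy t s hst.symm⟩
    refine absurd (hmin _ _ _ hfeas') (not_le.2 (Finset.sum_lt_sum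
      (fun i _ => (hf i).monotone ?_) ⟨t, mem_univ t, hf t ?_⟩))
    · nlinarith [hc0 i]
    · rw [hc, if_pos hpt]; nlinarith
  have hq : (fun i => p i + ε * inj G y a b i) = p := by
    funext i
    have : inj G y a b i = 0 := by
      rw [hc]; split_ifs with h
      · rw [hei i (by rintro rfl; exact hps h) (by rintro rfl; exact hpt h), neg_zero]
      · rfl
    simp [this]
  refine ⟨le_antisymm (not_lt.1 hps) (hpb s).1, u, X, ⟨hq ▸ hfeas', hmin⟩, fun i j h heq => ?_,
    fun j h => ?_⟩
  · rcases (hline i j h).lt_or_eq with hlt | heq'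
    · exact absurd heq (hεline i j h hlt).ne
    · exact hbind i j h heq'
  · by_cases hj : j = t
    · exact hj ▸ hXst
    · have hsj := hnot (i := s) (j := j) (by simp [hj, hne])
      rw [hsj.1, hsj.2]
      have has : 0 < a s := by
        simp only [a, hps, if_false]; exact div_pos hes (hes.trans_le (hed s))
      have hus : v s < u s := lt_add_of_pos_right _ (mul_pos hε has)
      exact (hrank s j h).trans_lt
        (mul_lt_mul hus (huv j) (hvpos j) ((hvpos s).le.trans hus.le))

end Exactness

/-- Theorem 6 of the paper: exactness of RL2. Assume `G` is
connected, the voltage upper bounds are uniform and positive, `pLo i ≤ 0`, and the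
cost functions are strictly increasing. Let `(p, v, W)` be an optimal solution of
RL2 with positive total injection. If either (i) no line constraint is binding at
it, or (ii) on every edge where the line constraint binds both power-injection
lower bounds are slack, then the rank constraint holds on every edge. -/
theorem rl2_exact {n : ℕ} (G : SimpleGraph (Fin n)) [DecidableRel G.Adj]
    (hconn : G.Connected)
    (y : Fin n → Fin n → ℝ) (pLo pHi VLo VHi : Fin n → ℝ)
    (Ibar : Fin n → Fin n → ℝ) (f : Fin n → ℝ → ℝ)
    (hVLo : ∀ i, 0 < VLo i) (hVbd : ∀ i, VLo i ≤ VHi i)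
    (hVHiuni : ∀ i j, VHi i = VHi j) (hVHipos : ∀ i, 0 < VHi i)
    (hpLo : ∀ i, pLo i ≤ 0) (hpHi : ∀ i, 0 ≤ pHi i)
    (hy : ∀ i j, G.Adj i j → 0 < y i j) (hysym : ∀ i j, y i j = y j i)
    (hI : ∀ i j, G.Adj i j → 0 < Ibar i j) (hIsym : ∀ i j, Ibar i j = Ibar j i)
    (hf : ∀ i, StrictMono (f i))
    (p v : Fin n → ℝ) (W : Fin n → Fin n → ℝ)
    (hopt : OptRL2 G y pLo pHi VLo VHi Ibar f p v W)
    (hloss : 0 < ∑ i, p i)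
    (hcond :
      (∀ i j, G.Adj i j →
        y i j ^ 2 * (v i - W i j - W j i + v j) < Ibar i j ^ 2) ∨
      (∀ s t, G.Adj s t →
        y s t ^ 2 * (v s - W s t - W t s + v t) = Ibar s t ^ 2 →
        pLo s < p s ∧ pLo t < p t)) :
    ∀ i j, G.Adj i j → W i j * W j i = v i * v j := by
  obtain ⟨r, -, hr⟩ : ∃ r ∈ univ, 0 < p r := by
    by_contra! h
    exact hloss.not_ge (Finset.sum_nonpos h)
  have hbind : ∀ i j, G.Adj i j → y i j ^ 2 * (v i - W i j - W j i + v j) = Ibar i j ^ 2 →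
      pLo i < p i ∧ pLo j < p j :=
    hcond.elim (fun h i j hij heq => absurd heq (h i j hij).ne) id
  have key : ∀ s, G.Walk s r → ∀ (v : Fin n → ℝ) (W : Fin n → Fin n → ℝ),
      OptRL2 G y pLo pHi VLo VHi Ibar f p v W →
      (∀ i j, G.Adj i j → y i j ^ 2 * (v i - W i j - W j i + v j) = Ibar i j ^ 2 →
        pLo i < p i ∧ pLo j < p j) →
      ∀ t, G.Adj s t → ¬ W s t * W t s < v s * v t := by
    intro s walk
    induction walk with
    | nil =>
      intro v W hopt hbind t hst hstrict
      have := (propagate_strict_edge hVHiuni hVHipos hVLo hpLo hy hf hopt hbind hst hstrict).1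
      exact absurd hr (not_lt.2 (this ▸ hpLo _))
    | @cons s w _ hsw _ ih =>
      intro v W hopt hbind t hst hstrict
      obtain ⟨-, u, X, hopt', hbind', hX⟩ :=
        propagate_strict_edge hVHiuni hVHipos hVLo hpLo hy hf hopt hbind hst hstrict
      refine ih hr u X hopt' hbind' s hsw.symm ?_
      linarith [hX w hsw]
  intro i j hij
  obtain ⟨walk⟩ := hconn.preconnected i r
  exact (hopt.1.1.2.2.2.2.2 i j hij).antisymm (not_lt.1 (key i walk v W hopt hbind j hij))
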